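/- arXiv:2410.21570 — 7 statements merged into one kernel-verified Lean document; each statement's English description precedes it below -/
import Mathlib

section
/- Let k be a positive natural number and let B be an invertible k×k real matrix. Suppose there exist real constants β₁, β₂ > 0 such that (1/2)(B + Bᵀ) − (β₁/2)·B·Bᵀ is positive semidefinite and (β₁/2)·B·Bᵀ − β₂·I is positive semidefinite. Then (1/2)(B⁻¹ + B⁻ᵀ) − (β₁/2)·I is positive semidefinite, (β₁/2)·I − β₂·B⁻¹·B⁻ᵀ is positive semidefinite, and B⁻¹·B⁻ᵀ is positive definite. -/
open Matrix

theorem dotProduct_mul_mul_transpose_mulVec {m n R : Type*} [Fintype m] [Fintype n] [CommSemiring R]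
    (C : Matrix m n R) (M : Matrix n n R) (x : m → R) :
    x ⬝ᵥ ((C * M * Cᵀ) *ᵥ x) = (Cᵀ *ᵥ x) ⬝ᵥ (M *ᵥ (Cᵀ *ᵥ x)) := by
  rw [← mulVec_mulVec, ← mulVec_mulVec, dotProduct_mulVec, mulVec_transpose]

/-- Lemma 1: the inequality ½(B+Bᵀ) ≽ (β₁/2)BBᵀ ≽ β₂I > 0 is transferred to the inverse of B. -/
theorem stmt_0 (k : ℕ) (hk : 0 < k) (B : Matrix (Fin k) (Fin k) ℝ)
    (hBinv : IsUnit B.det)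
    (β₁ β₂ : ℝ) (hβ₁ : 0 < β₁) (hβ₂ : 0 < β₂)
    (h1 : ∀ x : Fin k → ℝ,
      0 ≤ x ⬝ᵥ (((1 / 2 : ℝ) • (B + Bᵀ) - (β₁ / 2) • (B * Bᵀ)).mulVec x))
    (h2 : ∀ x : Fin k → ℝ,
      0 ≤ x ⬝ᵥ (((β₁ / 2) • (B * Bᵀ) - β₂ • (1 : Matrix (Fin k) (Fin k) ℝ)).mulVec x)) :
    (∀ x : Fin k → ℝ,
      0 ≤ x ⬝ᵥ (((1 / 2 : ℝ) • (B⁻¹ + (B⁻¹)ᵀ)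
        - (β₁ / 2) • (1 : Matrix (Fin k) (Fin k) ℝ)).mulVec x)) ∧
    (∀ x : Fin k → ℝ,
      0 ≤ x ⬝ᵥ (((β₁ / 2) • (1 : Matrix (Fin k) (Fin k) ℝ)
        - β₂ • (B⁻¹ * (B⁻¹)ᵀ)).mulVec x)) ∧
    (∀ x : Fin k → ℝ, x ≠ 0 → 0 < x ⬝ᵥ ((B⁻¹ * (B⁻¹)ᵀ).mulVec x)) := by
  have hl : B⁻¹ * B = 1 := nonsing_inv_mul B hBinv
  have hr : Bᵀ * (B⁻¹)ᵀ = 1 := by rw [← transpose_mul, hl, transpose_one]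
  have hBBt : B⁻¹ * (B * Bᵀ) * (B⁻¹)ᵀ = 1 := by
    rw [← Matrix.mul_assoc, hl, Matrix.one_mul, hr]
  have hSum : B⁻¹ * (B + Bᵀ) * (B⁻¹)ᵀ = B⁻¹ + (B⁻¹)ᵀ := by
    rw [Matrix.mul_add, Matrix.add_mul, hl, Matrix.one_mul, Matrix.mul_assoc, hr,
      Matrix.mul_one, add_comm]
  refine ⟨fun x => ?_, fun x => ?_, fun x hx => ?_⟩
  · have h := h1 ((B⁻¹)ᵀ *ᵥ x)
    rw [← dotProduct_mul_mul_transpose_mulVec] at h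
    simpa only [Matrix.mul_sub, Matrix.sub_mul, Matrix.mul_smul, Matrix.smul_mul, hBBt,
      hSum] using h
  · have h := h2 ((B⁻¹)ᵀ *ᵥ x)
    rw [← dotProduct_mul_mul_transpose_mulVec] at h
    simpa only [Matrix.mul_sub, Matrix.sub_mul, Matrix.mul_smul, Matrix.smul_mul, hBBt,
      Matrix.mul_one] using h
  · have h := dotProduct_mul_mul_transpose_mulVec B⁻¹ 1 x
    rw [Matrix.mul_one, one_mulVec] at h
    rw [h]
    have hne : (B⁻¹)ᵀ *ᵥ x ≠ 0 := fun h0 => hx <| by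
      rw [← one_mulVec x, ← hr, ← mulVec_mulVec, h0, mulVec_zero]
    simpa using dotProduct_star_self_pos_iff.mpr hne
end

section
/- Let n and k be natural numbers with k ≤ n. Let A and J be k×n real matrices and let G be an (n−k)×n real matrix. Assume: (i) the k×k matrix J·Aᵀ is invertible; (ii) G·Jᵀ = 0; and (iii) G has full row rank n−k. Then the n×n matrix obtained by stacking A on top of G is invertible, and consequently the n×n Gram matrix Aᵀ·A + Gᵀ·G is positive definite (in particular there exists φ > 0 with Aᵀ·A + Gᵀ·G ≽ φ·I). -/
open Matrix

namespace Matrix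

variable {m n : Type*} [Fintype m] [Fintype n]

theorem vecMul_injective_of_rank_eq_card {K : Type*} [Field K] (G : Matrix m n K)
    (hG : G.rank = Fintype.card m) : Function.Injective G.vecMul := by
  rw [vecMul_injective_iff, linearIndependent_iff_card_eq_finrank_span, Set.finrank,
    ← rank_eq_finrank_span_row, hG]

/-- If `J * Aᵀ` is injective on the left factor and `G * Jᵀ = 0`, then the rows of `A` and `G`
are jointly independent as soon as the rows of `G` are. -/
theorem vecMul_fromRows_injective {R k : Type*} [CommRing R] [Fintype k] [DecidableEq k]
    (A J : Matrix k n R) (G : Matrix m n R) (hB : IsUnit (J * Aᵀ).det) (hGJ : G * Jᵀ = 0)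
    (hG : Function.Injective G.vecMul) : Function.Injective (fromRows A G).vecMul := by
  refine (injective_iff_map_eq_zero (vecMulLinear (fromRows A G))).2 fun w hw => ?_
  obtain ⟨u, v, rfl⟩ : ∃ u v, w = Sum.elim u v := ⟨_, _, (Sum.elim_comp_inl_inr w).symm⟩
  have hw' : u ᵥ* A + v ᵥ* G = 0 := by simpa using hw
  have hu : u = 0 := by
    have h := congrArg (· ᵥ* Jᵀ) hw'
    simp only [add_vecMul, vecMul_vecMul, hGJ, vecMul_zero, add_zero, zero_vecMul] at h
    have hAJ : IsUnit (A * Jᵀ) := by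
      rw [isUnit_iff_isUnit_det, ← det_transpose, transpose_mul, transpose_transpose]
      exact hB
    exact vecMul_injective_of_isUnit hAJ (by simpa using h)
  subst hu
  have hv : v = 0 := hG (by simpa using hw')
  subst hv
  simp

theorem mulVec_injective_of_vecMul_injective (S : Matrix m n ℝ)
    (hcard : Fintype.card m = Fintype.card n) (hS : Function.Injective S.vecMul) :
    Function.Injective S.mulVec := by
  have hsurj : Function.Surjective S.vecMulLinear :=
    (LinearMap.injective_iff_surjective_of_finrank_eq_finrank (by simpa using hcard)).1 hS
  refine (injective_iff_map_eq_zero S.mulVecLin).2 fun x hx => ?_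
  obtain ⟨w, hw⟩ := hsurj x
  have hw' : w ᵥ* S = x := hw
  have hx' : S *ᵥ x = 0 := hx
  rw [← dotProduct_self_eq_zero]
  nth_rewrite 1 [← hw']
  rw [← dotProduct_mulVec, hx', dotProduct_zero]

theorem norm_toLp_sq_eq_dotProduct (y : n → ℝ) : ‖WithLp.toLp 2 y‖ ^ 2 = y ⬝ᵥ y := by
  simp [EuclideanSpace.real_norm_sq_eq, dotProduct, ← sq]

theorem exists_pos_mul_dotProduct_le_of_mulVec_injective (S : Matrix m n ℝ)
    (hS : Function.Injective S.mulVec) :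
    ∃ φ : ℝ, 0 < φ ∧ ∀ x : n → ℝ, φ * (x ⬝ᵥ x) ≤ (S *ᵥ x) ⬝ᵥ (S *ᵥ x) := by
  classical
  have hker : LinearMap.ker (toEuclideanLin S) = ⊥ := by
    refine LinearMap.ker_eq_bot.2 fun x y hxy => ?_
    exact WithLp.ofLp_injective 2 (hS (congrArg WithLp.ofLp hxy))
  obtain ⟨K, hK, hKS⟩ := (toEuclideanLin S).exists_antilipschitzWith hker
  have hK' : (0 : ℝ) < K := hK
  refine ⟨((K : ℝ) ^ 2)⁻¹, by positivity, fun x => ?_⟩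
  have h := hKS.le_mul_dist (WithLp.toLp 2 x) 0
  rw [map_zero, dist_zero_right, dist_zero_right, toLpLin_toLp, toLin'_apply] at h
  rw [inv_mul_le_iff₀ (by positivity), ← norm_toLp_sq_eq_dotProduct,
    ← norm_toLp_sq_eq_dotProduct, ← mul_pow]
  exact pow_le_pow_left₀ (norm_nonneg _) h 2

theorem dotProduct_gram_add_gram_mulVec {R k : Type*} [CommRing R] [Fintype k]
    (A : Matrix k n R) (G : Matrix m n R) (x : n → R) :
    x ⬝ᵥ ((Aᵀ * A + Gᵀ * G) *ᵥ x) = (fromRows A G *ᵥ x) ⬝ᵥ (fromRows A G *ᵥ x) := by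
  have hgram : Aᵀ * A + Gᵀ * G = (fromRows A G)ᵀ * fromRows A G := by
    rw [transpose_fromRows, fromCols_mul_fromRows]
  rw [hgram, ← mulVec_mulVec, dotProduct_mulVec, vecMul_transpose]

end Matrix

/-- Lemma 2: the stacked matrix [A; G] is invertible, hence AᵀA + GᵀG is positive definite. -/
theorem stmt_1 (n k : ℕ) (hkn : k ≤ n)
    (A J : Matrix (Fin k) (Fin n) ℝ) (G : Matrix (Fin (n - k)) (Fin n) ℝ)
    (hB : IsUnit (J * Aᵀ).det)
    (hGJ : G * Jᵀ = 0)
    (hG : G.rank = n - k) :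
    Function.Bijective (fun x : Fin n → ℝ => (Matrix.fromRows A G).mulVec x) ∧
    (∀ x : Fin n → ℝ, x ≠ 0 → 0 < x ⬝ᵥ ((Aᵀ * A + Gᵀ * G).mulVec x)) ∧
    (∃ φ : ℝ, 0 < φ ∧ ∀ x : Fin n → ℝ,
      φ * (x ⬝ᵥ x) ≤ x ⬝ᵥ ((Aᵀ * A + Gᵀ * G).mulVec x)) := by
  have hcard : Fintype.card (Fin k ⊕ Fin (n - k)) = Fintype.card (Fin n) := by
    simp [Nat.add_sub_cancel' hkn]
  have hinj : Function.Injective (fromRows A G).mulVec :=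
    mulVec_injective_of_vecMul_injective _ hcard <| vecMul_fromRows_injective A J G hB hGJ <|
      vecMul_injective_of_rank_eq_card G (by simpa using hG)
  have hsurj : Function.Surjective (fromRows A G).mulVecLin :=
    (LinearMap.injective_iff_surjective_of_finrank_eq_finrank (by simpa using hcard.symm)).1 hinj
  obtain ⟨φ, hφ, hle⟩ := exists_pos_mul_dotProduct_le_of_mulVec_injective _ hinj
  simp only [dotProduct_gram_add_gram_mulVec]
  refine ⟨⟨hinj, hsurj⟩, fun x hx => ?_, φ, hφ, hle⟩
  have hxx : 0 < x ⬝ᵥ x := by simpa using dotProduct_star_self_pos_iff.2 hx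
  exact (mul_pos hφ hxx).trans_le (hle x)
end

section
/- Let n, k be natural numbers with k ≤ n. Let A, J be k×n real matrices, G an (n−k)×n real matrix, d ∈ ℝᵏ, v ∈ ℝⁿ, and κ₁, κ₂ > 0 real constants. Set B = J·Aᵀ and h = −κ₁·Aᵀ·B⁻¹·(A·v + d) − κ₂·Gᵀ·G·v. If B is invertible, G·Jᵀ = 0, and the constraint is satisfied, i.e., A·v + d = 0, then the inner product of v with h satisfies vᵀ·h = −κ₂·‖G·v‖² ≤ 0. -/
open Matrix

/-- Proposition 4, Claim 1: on the feasibility set, vᵀh = −κ₂‖Gv‖² ≤ 0. -/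
theorem stmt_4 (n k : ℕ) (hkn : k ≤ n)
    (A J : Matrix (Fin k) (Fin n) ℝ) (G : Matrix (Fin (n - k)) (Fin n) ℝ)
    (d : Fin k → ℝ) (v : Fin n → ℝ) (κ₁ κ₂ : ℝ) (hκ₁ : 0 < κ₁) (hκ₂ : 0 < κ₂)
    (B : Matrix (Fin k) (Fin k) ℝ) (hB : B = J * Aᵀ)
    (h : Fin n → ℝ)
    (hh : h = -(κ₁ • Aᵀ.mulVec (B⁻¹.mulVec (A.mulVec v + d)))
      - κ₂ • Gᵀ.mulVec (G.mulVec v))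
    (hBinv : IsUnit B.det)
    (hGJ : G * Jᵀ = 0)
    (hfeas : A.mulVec v + d = 0) :
    v ⬝ᵥ h = -(κ₂ * ((G.mulVec v) ⬝ᵥ (G.mulVec v))) ∧ v ⬝ᵥ h ≤ 0 := by
  have key : v ⬝ᵥ h = -(κ₂ * ((G.mulVec v) ⬝ᵥ (G.mulVec v))) := by
    rw [hh, hfeas, mulVec_zero, mulVec_zero, smul_zero, neg_zero, zero_sub, dotProduct_neg,
      dotProduct_smul, dotProduct_mulVec, vecMul_transpose, smul_eq_mul]
  have hnonneg : 0 ≤ (G.mulVec v) ⬝ᵥ (G.mulVec v) :=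
    Finset.sum_nonneg fun i _ => mul_self_nonneg _
  exact ⟨key, key ▸ neg_nonpos.mpr (mul_nonneg hκ₂.le hnonneg)⟩
end

section
/- Let n, k be natural numbers with k ≤ n. Let A, J be k×n real matrices, G an (n−k)×n real matrix, d ∈ ℝᵏ, v ∈ ℝⁿ, and κ₁, κ₂ > 0 real constants. Set B = J·Aᵀ and h = −κ₁·Aᵀ·B⁻¹·(A·v + d) − κ₂·Gᵀ·G·v. Assume B is invertible and G·Jᵀ = 0. Then h = 0 if and only if both A·v + d = 0 and G·v = 0. -/
open Matrix

/-- Proposition 5, first part: h = 0 iff A·v + d = 0 and G·v = 0. -/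
theorem stmt_5 (n k : ℕ) (hkn : k ≤ n)
    (A J : Matrix (Fin k) (Fin n) ℝ) (G : Matrix (Fin (n - k)) (Fin n) ℝ)
    (d : Fin k → ℝ) (v : Fin n → ℝ) (κ₁ κ₂ : ℝ) (hκ₁ : 0 < κ₁) (hκ₂ : 0 < κ₂)
    (B : Matrix (Fin k) (Fin k) ℝ) (hB : B = J * Aᵀ)
    (h : Fin n → ℝ)
    (hh : h = -(κ₁ • Aᵀ.mulVec (B⁻¹.mulVec (A.mulVec v + d)))
      - κ₂ • Gᵀ.mulVec (G.mulVec v))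
    (hBinv : IsUnit B.det)
    (hGJ : G * Jᵀ = 0) :
    h = 0 ↔ (A.mulVec v + d = 0 ∧ G.mulVec v = 0) := by
  have hJG : J * Gᵀ = 0 := by
    simpa using congrArg transpose hGJ
  constructor
  · intro h0
    rw [h0] at hh
    have hg : A.mulVec v + d = 0 := by
      have hJ := congrArg J.mulVec hh
      rw [mulVec_zero, mulVec_sub, mulVec_neg, mulVec_smul, mulVec_smul, mulVec_mulVec,
        mulVec_mulVec, mulVec_mulVec, hJG, ← hB, mul_nonsing_inv B hBinv, one_mulVec,
        zero_mulVec, smul_zero, sub_zero, eq_comm, neg_eq_zero, smul_eq_zero] at hJ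
      exact hJ.resolve_left hκ₁.ne'
    refine ⟨hg, ?_⟩
    rw [hg, mulVec_zero, mulVec_zero, smul_zero, neg_zero, zero_sub, eq_comm, neg_eq_zero,
      smul_eq_zero, mulVec_mulVec, ← conjTranspose_eq_transpose_of_trivial,
      conjTranspose_mul_self_mulVec_eq_zero] at hh
    exact hh.resolve_left hκ₂.ne'
  · rintro ⟨hg, hGv⟩
    simp [hh, hg, hGv]
end

section
/- Let n, k be natural numbers with k ≤ n. Let A, J be k×n real matrices and G an (n−k)×n real matrix, and let d ∈ ℝᵏ and v ∈ ℝⁿ. Assume: (i) J has full row rank k; (ii) G has full row rank n−k; (iii) G·Jᵀ = 0; (iv) G·v = 0; and (v) B = J·Aᵀ is invertible and A·v + d = 0. Then there exists a unique vector μ ∈ ℝᵏ such that v + Jᵀ·μ = 0, and this vector is given explicitly by μ = B⁻ᵀ·d (the transpose of the inverse of B applied to d). -/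
open Matrix

/-- If `G * M = 0` and the ranks of `G` and `M` add up to the dimension of the middle space,
then the kernel of `G` is exactly the range of `M`. -/
theorem Matrix.range_mulVecLin_eq_ker_of_mul_eq_zero {K l m n : Type*} [Field K] [Fintype m]
    [Fintype n] (G : Matrix l n K) (M : Matrix n m K) (hGM : G * M = 0)
    (hrank : G.rank + M.rank = Fintype.card n) :
    LinearMap.range M.mulVecLin = LinearMap.ker G.mulVecLin := by
  apply Submodule.eq_of_le_of_finrank_eq
  · rintro _ ⟨x, rfl⟩
    simp [Matrix.mulVec_mulVec, hGM]
  · have hnull := LinearMap.finrank_range_add_finrank_ker G.mulVecLin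
    rw [Module.finrank_fintype_fun_eq_card] at hnull
    unfold Matrix.rank at hrank
    omega

/-- Proposition 5, second part: existence and uniqueness of the Lagrange multipliers,
with explicit formula μ = B⁻ᵀ·d. -/
theorem stmt_6 (n k : ℕ) (hkn : k ≤ n)
    (A J : Matrix (Fin k) (Fin n) ℝ) (G : Matrix (Fin (n - k)) (Fin n) ℝ)
    (d : Fin k → ℝ) (v : Fin n → ℝ)
    (hJrank : J.rank = k)
    (hGrank : G.rank = n - k)
    (hGJ : G * Jᵀ = 0)
    (hGv : G.mulVec v = 0)
    (B : Matrix (Fin k) (Fin k) ℝ) (hB : B = J * Aᵀ)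
    (hBinv : IsUnit B.det)
    (hfeas : A.mulVec v + d = 0) :
    (∃! μ : Fin k → ℝ, v + Jᵀ.mulVec μ = 0) ∧
    v + Jᵀ.mulVec ((B⁻¹)ᵀ.mulVec d) = 0 := by
  have hrange : LinearMap.range Jᵀ.mulVecLin = LinearMap.ker G.mulVecLin :=
    G.range_mulVecLin_eq_ker_of_mul_eq_zero Jᵀ hGJ (by
      rw [rank_transpose, hJrank, hGrank, Fintype.card_fin]
      omega)
  have hmem : -v ∈ LinearMap.range Jᵀ.mulVecLin := by
    rw [hrange, LinearMap.mem_ker, mulVecLin_apply, mulVec_neg, hGv, neg_zero]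
  obtain ⟨ν, hν⟩ := hmem
  rw [mulVecLin_apply] at hν
  have hsol : v + Jᵀ *ᵥ ν = 0 := by rw [hν, add_neg_cancel]
  have hformula : ∀ μ : Fin k → ℝ, v + Jᵀ *ᵥ μ = 0 → μ = (B⁻¹)ᵀ *ᵥ d := by
    intro μ hμ
    have hBμ : Bᵀ *ᵥ μ = d := by
      rw [hB, transpose_mul, transpose_transpose, ← mulVec_mulVec,
        eq_neg_of_add_eq_zero_right hμ, mulVec_neg, eq_neg_of_add_eq_zero_left hfeas, neg_neg]
    rw [← hBμ, mulVec_mulVec, ← transpose_mul, mul_nonsing_inv B hBinv, transpose_one,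
      one_mulVec]
  refine ⟨⟨ν, hsol, fun μ hμ => ?_⟩, ?_⟩
  · rw [hformula μ hμ, hformula ν hsol]
  · rw [← hformula ν hsol, hsol]
end

section
/- Let n, k be natural numbers with k ≤ n. Let A, J be k×n real matrices, G an (n−k)×n real matrix, d ∈ ℝᵏ, v ∈ ℝⁿ, and κ₁, κ₂ > 0. Set B = J·Aᵀ and h = −κ₁·Aᵀ·B⁻¹·(A·v + d) − κ₂·Gᵀ·G·v. Assume there exist constants β₁, β₂, φ > 0 such that: (i) B is invertible; (ii) (1/2)(B + Bᵀ) − (β₁/2)·B·Bᵀ is positive semidefinite; (iii) (β₁/2)·B·Bᵀ − β₂·I is positive semidefinite; and (iv) Aᵀ·A + Gᵀ·G − φ·I is positive semidefinite. Then vᵀ·h ≤ −min{κ₁β₁/4, κ₂}·φ·‖v‖² + (κ₁/(2β₂))·‖d‖². -/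
open Matrix

/-- Core ISS-Lyapunov inequality of Proposition 2:
vᵀh ≤ −min{κ₁β₁/4, κ₂}·φ·‖v‖² + (κ₁/(2β₂))·‖d‖². -/
theorem stmt_7 (n k : ℕ) (hkn : k ≤ n)
    (A J : Matrix (Fin k) (Fin n) ℝ) (G : Matrix (Fin (n - k)) (Fin n) ℝ)
    (d : Fin k → ℝ) (v : Fin n → ℝ) (κ₁ κ₂ : ℝ) (hκ₁ : 0 < κ₁) (hκ₂ : 0 < κ₂)
    (B : Matrix (Fin k) (Fin k) ℝ) (hB : B = J * Aᵀ)
    (h : Fin n → ℝ)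
    (hh : h = -(κ₁ • Aᵀ.mulVec (B⁻¹.mulVec (A.mulVec v + d)))
      - κ₂ • Gᵀ.mulVec (G.mulVec v))
    (β₁ β₂ φ : ℝ) (hβ₁ : 0 < β₁) (hβ₂ : 0 < β₂) (hφ : 0 < φ)
    (hBinv : IsUnit B.det)
    (h1 : ∀ x : Fin k → ℝ,
      0 ≤ x ⬝ᵥ (((1 / 2 : ℝ) • (B + Bᵀ) - (β₁ / 2) • (B * Bᵀ)).mulVec x))
    (h2 : ∀ x : Fin k → ℝ,
      0 ≤ x ⬝ᵥ (((β₁ / 2) • (B * Bᵀ) - β₂ • (1 : Matrix (Fin k) (Fin k) ℝ)).mulVec x))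
    (h3 : ∀ x : Fin n → ℝ,
      0 ≤ x ⬝ᵥ ((Aᵀ * A + Gᵀ * G - φ • (1 : Matrix (Fin n) (Fin n) ℝ)).mulVec x)) :
    v ⬝ᵥ h ≤ -(min (κ₁ * β₁ / 4) κ₂ * φ * (v ⬝ᵥ v)) + (κ₁ / (2 * β₂)) * (d ⬝ᵥ d) := by
  set w := A *ᵥ v with hw
  set x := (B⁻¹)ᵀ *ᵥ w with hx
  have hxw : Bᵀ *ᵥ x = w := by
    rw [hx, mulVec_mulVec, ← transpose_mul, nonsing_inv_mul _ hBinv, transpose_one, one_mulVec]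
  have hgram : ∀ {p q : ℕ} (M : Matrix (Fin p) (Fin q) ℝ) (u : Fin q → ℝ),
      u ⬝ᵥ ((Mᵀ * M) *ᵥ u) = (M *ᵥ u) ⬝ᵥ (M *ᵥ u) := by
    intro p q M u
    rw [← mulVec_mulVec, dotProduct_mulVec, vecMul_transpose]
  have hBB : x ⬝ᵥ ((B * Bᵀ) *ᵥ x) = w ⬝ᵥ w := by
    simpa only [transpose_transpose, hxw] using hgram Bᵀ x
  have hBx : x ⬝ᵥ (B *ᵥ x) = x ⬝ᵥ w := by
    rw [dotProduct_mulVec, ← mulVec_transpose, hxw, dotProduct_comm]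
  have hcoercive := h1 x
  simp only [sub_mulVec, smul_mulVec, add_mulVec, dotProduct_sub, dotProduct_smul,
    dotProduct_add, smul_eq_mul, hBB, hBx, hxw] at hcoercive
  have hbound := h2 x
  simp only [sub_mulVec, smul_mulVec, one_mulVec, dotProduct_sub, dotProduct_smul,
    smul_eq_mul, hBB] at hbound
  have hstack := h3 v
  simp only [sub_mulVec, smul_mulVec, add_mulVec, one_mulVec, dotProduct_sub, dotProduct_smul,
    dotProduct_add, smul_eq_mul, hgram, ← hw] at hstack
  have hvh : v ⬝ᵥ h = -(κ₁ * (x ⬝ᵥ w + x ⬝ᵥ d)) - κ₂ * ((G *ᵥ v) ⬝ᵥ (G *ᵥ v)) := by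
    have hA : v ⬝ᵥ (Aᵀ *ᵥ (B⁻¹ *ᵥ (w + d))) = x ⬝ᵥ (w + d) := by
      rw [dotProduct_mulVec, vecMul_transpose, ← hw, dotProduct_mulVec, hx, mulVec_transpose]
    rw [hh, dotProduct_sub, dotProduct_neg, dotProduct_smul, dotProduct_smul, hA,
      mulVec_mulVec, hgram, dotProduct_add, smul_eq_mul, smul_eq_mul]
  have hyoung : -(x ⬝ᵥ d) ≤ β₂ / 2 * (x ⬝ᵥ x) + 1 / (2 * β₂) * (d ⬝ᵥ d) := by
    have hsq : 0 ≤ (β₂ • x + d) ⬝ᵥ (β₂ • x + d) :=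
      Finset.sum_nonneg fun i _ => mul_self_nonneg _
    simp only [dotProduct_add, add_dotProduct, dotProduct_smul, smul_dotProduct, smul_eq_mul,
      dotProduct_comm d x] at hsq
    have hscale := mul_nonneg (by positivity : 0 ≤ 1 / (2 * β₂)) hsq
    have hexpand : 1 / (2 * β₂) * (β₂ * (β₂ * (x ⬝ᵥ x)) + β₂ * (x ⬝ᵥ d)
        + (β₂ * (x ⬝ᵥ d) + d ⬝ᵥ d))
        = β₂ / 2 * (x ⬝ᵥ x) + x ⬝ᵥ d + 1 / (2 * β₂) * (d ⬝ᵥ d) := by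
      field_simp
      ring
    linarith
  have hdissip : -(κ₁ * (x ⬝ᵥ w + x ⬝ᵥ d))
      ≤ -(κ₁ * β₁ / 4 * (w ⬝ᵥ w)) + κ₁ / (2 * β₂) * (d ⬝ᵥ d) := by
    have hsum : -(x ⬝ᵥ w + x ⬝ᵥ d) ≤ -(β₁ / 4 * (w ⬝ᵥ w)) + 1 / (2 * β₂) * (d ⬝ᵥ d) := by
      linarith
    calc -(κ₁ * (x ⬝ᵥ w + x ⬝ᵥ d)) = κ₁ * -(x ⬝ᵥ w + x ⬝ᵥ d) := by ring
      _ ≤ κ₁ * (-(β₁ / 4 * (w ⬝ᵥ w)) + 1 / (2 * β₂) * (d ⬝ᵥ d)) :=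
        mul_le_mul_of_nonneg_left hsum hκ₁.le
      _ = _ := by ring
  have hw0 : 0 ≤ w ⬝ᵥ w := Finset.sum_nonneg fun i _ => mul_self_nonneg _
  have hG0 : 0 ≤ (G *ᵥ v) ⬝ᵥ (G *ᵥ v) := Finset.sum_nonneg fun i _ => mul_self_nonneg _
  have hm : 0 ≤ min (κ₁ * β₁ / 4) κ₂ := le_min (by positivity) hκ₂.le
  have hmin₁ := mul_le_mul_of_nonneg_right (min_le_left (κ₁ * β₁ / 4) κ₂) hw0
  have hmin₂ := mul_le_mul_of_nonneg_right (min_le_right (κ₁ * β₁ / 4) κ₂) hG0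
  have hmin := mul_nonneg hm hstack
  rw [hvh]
  linarith
end

section
/- Let n, k, l be natural numbers. Let J be a k×n real matrix, G an l×n real matrix with G·Jᵀ = 0, j ∈ ℝⁿ a vector, κ₂ > 0 a real constant, μ ∈ ℝᵏ and ν ∈ ℝ. Suppose v ∈ ℝⁿ satisfies v = −Jᵀ·μ − ν·j, and set h = −κ₂·Gᵀ·G·v. Then: (a) h = κ₂·ν·Gᵀ·G·j; (b) vᵀ·h = −κ₂·ν²·‖G·j‖². In particular, if ν < 0 and G·j ≠ 0, then jᵀ·h = κ₂·ν·‖G·j‖² < 0 and vᵀ·h = −κ₂·ν²·‖G·j‖² < 0. -/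
open Matrix

/-- Proposition 6, Case 2: at a non-KKT equilibrium (ν < 0) the switch occurs and
the objective strictly decreases. -/
theorem stmt_11 (n k l : ℕ)
    (J : Matrix (Fin k) (Fin n) ℝ) (G : Matrix (Fin l) (Fin n) ℝ)
    (hGJ : G * Jᵀ = 0)
    (j : Fin n → ℝ) (κ₂ : ℝ) (hκ₂ : 0 < κ₂)
    (μ : Fin k → ℝ) (ν : ℝ)
    (v : Fin n → ℝ) (hv : v = -(Jᵀ.mulVec μ) - ν • j)
    (h : Fin n → ℝ) (hh : h = -(κ₂ • Gᵀ.mulVec (G.mulVec v))) :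
    h = (κ₂ * ν) • Gᵀ.mulVec (G.mulVec j) ∧
    v ⬝ᵥ h = -(κ₂ * ν ^ 2 * ((G.mulVec j) ⬝ᵥ (G.mulVec j))) ∧
    (ν < 0 → G.mulVec j ≠ 0 →
      j ⬝ᵥ h = κ₂ * ν * ((G.mulVec j) ⬝ᵥ (G.mulVec j)) ∧
      j ⬝ᵥ h < 0 ∧ v ⬝ᵥ h < 0) := by
  have hGv : G.mulVec v = -(ν • G.mulVec j) := by
    rw [hv, mulVec_sub, mulVec_neg, mulVec_mulVec, hGJ, zero_mulVec, mulVec_smul, neg_zero,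
      zero_sub]
  have h_eq : h = (κ₂ * ν) • Gᵀ.mulVec (G.mulVec j) := by
    rw [hh, hGv, mulVec_neg, mulVec_smul, smul_neg, neg_neg, smul_smul]
  have h_dot (w : Fin n → ℝ) : w ⬝ᵥ h = κ₂ * ν * (G.mulVec w ⬝ᵥ G.mulVec j) := by
    rw [h_eq, dotProduct_smul, smul_eq_mul, dotProduct_mulVec, vecMul_transpose]
  have hv_dot : v ⬝ᵥ h = -(κ₂ * ν ^ 2 * (G.mulVec j ⬝ᵥ G.mulVec j)) := by
    rw [h_dot, hGv, neg_dotProduct, smul_dotProduct, smul_eq_mul]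
    ring
  refine ⟨h_eq, hv_dot, fun hν hGj => ?_⟩
  have h_pos : 0 < G.mulVec j ⬝ᵥ G.mulVec j := by
    simpa using dotProduct_star_self_pos_iff.mpr hGj
  refine ⟨h_dot j, ?_, ?_⟩
  · rw [h_dot]
    exact mul_neg_of_neg_of_pos (mul_neg_of_pos_of_neg hκ₂ hν) h_pos
  · rw [hv_dot, neg_lt_zero]
    have := sq_pos_of_neg hν
    positivity
end
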